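/- (Theorem 3: closed-loop performance.) Let Assumptions 1–5 hold, let (x_s,u_s)∈Z be a steady-state (f(x_s,u_s)=x_s, h_s:=h(x_s,u_s)≤0 componentwise), and assume both J*_N and J̃*_N are attained by unique minimizers for every horizon and every initial condition in X×𝕳. Then there exist N₂,N₆∈ℕ and σ₃,σ₆∈L_ℕ such that, with N_{6,1}:=N₂+T²+1 and N_{6,2}:=N₂+(4T+1)(T−1)+1, for all χ=(x,H)∈X×𝕳, all K∈ℕ and all N≥N₆+1: (i) J^{cl}_K(χ) ≤ J*_N(χ) − J*_N(χ_{μN}(K,χ)) + K·(ℓ_s + σ₃(N−N_{6,1})); and (ii) J̃^{cl}_K(χ) ≤ J̃*_N(χ) − J̃*_N(χ_{μN}(K,χ)) + σ₆(N−N_{6,2}) + K·σ₃(N−N_{6,1}) + ψ(x,H) + Σ_{k=0}^{K−1} λ̄ᵀ h_{μN}(k,χ). -/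

import Mathlib

open Finset Filter
open scoped Classical

noncomputable section

namespace EMPC

abbrev Vec (n : ℕ) : Type := EuclideanSpace ℝ (Fin n)

variable {n m p : ℕ}

/-- Trajectory of the discrete-time system `x(k+1) = f(x(k), u(k))`. -/
def traj (f : Vec n → Vec m → Vec n) (x : Vec n) (u : ℕ → Vec m) : ℕ → Vec n
  | 0 => x
  | k + 1 => f (traj f x u k) (u k)

/-- Open-loop cost `J_N(x,u)`. -/
def cost (f : Vec n → Vec m → Vec n) (ℓ : Vec n → Vec m → ℝ) (x : Vec n)
    (u : ℕ → Vec m) (N : ℕ) : ℝ :=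
  ∑ k ∈ Finset.range N, ℓ (traj f x u k) (u k)

/-- Admissibility `u ∈ U^N(x,H)` for the transient average constrained problem. -/
def Admissible (f : Vec n → Vec m → Vec n) (h : Vec n → Vec m → Vec p)
    (Z : Set (Vec n × Vec m)) (T N : ℕ) (x : Vec n) (H : ℕ → Vec p)
    (u : ℕ → Vec m) : Prop :=
  (∀ k < N, (traj f x u k, u k) ∈ Z) ∧
  (∀ j ∈ Finset.Icc 1 (T - 1), ∀ i : Fin p,
    (∑ l ∈ Finset.Icc j (T - 1), H l i)
      + ∑ k ∈ Finset.range j, h (traj f x u k) (u k) i ≤ 0) ∧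
  (∀ s : ℕ, s + T ≤ N → ∀ i : Fin p,
    ∑ k ∈ Finset.Ico s (s + T), h (traj f x u k) (u k) i ≤ 0)

/-- Class `K∞` comparison functions. -/
def KInf (α : ℝ → ℝ) : Prop :=
  ContinuousOn α (Set.Ici 0) ∧ StrictMonoOn α (Set.Ici 0) ∧ α 0 = 0 ∧
    Tendsto α atTop atTop

/-- Class `L_ℕ`: decreasing functions on ℕ with limit 0. -/
def LN (δ : ℕ → ℝ) : Prop :=
  Antitone δ ∧ (∀ k, 0 ≤ δ k) ∧ Tendsto δ atTop (nhds 0)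

/-- Class `KLS`. -/
def KLS (β : ℝ → ℕ → ℝ) : Prop :=
  (∀ k : ℕ, ContinuousOn (fun r => β r k) (Set.Ici 0) ∧
    StrictMonoOn (fun r => β r k) (Set.Ici 0) ∧ β 0 k = 0) ∧
  (∀ r : ℝ, 0 ≤ r → LN (fun k => β r k)) ∧
  (∀ r : ℝ, 0 ≤ r → Summable (fun k => β r k)) ∧
  (ContinuousOn (fun r => ∑' k, β r k) (Set.Ici 0) ∧
    StrictMonoOn (fun r => ∑' k, β r k) (Set.Ici 0) ∧ (∑' k, β 0 k) = 0)

/-- Class `KL`. -/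
def KLcl (β : ℝ → ℝ → ℝ) : Prop :=
  ContinuousOn (fun q : ℝ × ℝ => β q.1 q.2) (Set.Ici 0 ×ˢ Set.Ici 0) ∧
  (∀ s : ℝ, 0 ≤ s → StrictMonoOn (fun r => β r s) (Set.Ici 0) ∧ β 0 s = 0) ∧
  (∀ r : ℝ, 0 ≤ r → AntitoneOn (fun s => β r s) (Set.Ici 0) ∧
    Tendsto (fun s => β r s) atTop (nhds 0)) ∧
  (∀ r s : ℝ, 0 ≤ r → 0 ≤ s → 0 ≤ β r s)

/-- ℓ¹-norm of a vector. -/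
def l1 (v : Vec p) : ℝ := ∑ i, |v i|

/-- `Ĥ_k = Σ_i max{H_{ik}, 0}`. -/
def hatCol (H : ℕ → Vec p) (k : ℕ) : ℝ := ∑ i, max (H k i) 0

/-- Norm-like measure `⟨H⟩ = max_{k ∈ {1,…,T-1}} Ĥ_k`. -/
def measH (T : ℕ) (H : ℕ → Vec p) : ℝ := ⨆ k ∈ Finset.Icc 1 (T - 1), hatCol H k

/-- `‖H‖₁ = max_{k ∈ {1,…,T-1}} ‖H_k‖₁`. -/
def norm1H (T : ℕ) (H : ℕ → Vec p) : ℝ := ⨆ k ∈ Finset.Icc 1 (T - 1), l1 (H k)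

/-- The set `𝕳` of feasible stored outputs. -/
def HSet (h : Vec n → Vec m → Vec p) (Z : Set (Vec n × Vec m)) (T : ℕ) :
    Set (ℕ → Vec p) :=
  {H | ∀ k ∈ Finset.Icc 1 (T - 1), ∀ i : Fin p,
    sInf ((fun z : Vec n × Vec m => h z.1 z.2 i) '' Z) ≤ H k i ∧
    H k i ≤ sSup ((fun z : Vec n × Vec m => h z.1 z.2 i) '' Z)}

/-- Value function `J*_N(x,H)`. -/
def Jstar (f : Vec n → Vec m → Vec n) (ℓ : Vec n → Vec m → ℝ)
    (h : Vec n → Vec m → Vec p) (Z : Set (Vec n × Vec m)) (T N : ℕ)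
    (x : Vec n) (H : ℕ → Vec p) : ℝ :=
  sInf ((fun u => cost f ℓ x u N) '' {u | Admissible f h Z T N x H u})

/-- Rotated stage cost `ℓ̃`. -/
def rot (f : Vec n → Vec m → Vec n) (ℓ : Vec n → Vec m → ℝ)
    (h : Vec n → Vec m → Vec p) (ℓs : ℝ) (lam : Vec n → ℝ) (lb : Vec p)
    (x : Vec n) (u : Vec m) : ℝ :=
  ℓ x u - ℓs + lam x - lam (f x u) + ∑ i, lb i * h x u i

/-- Rotated open-loop cost. -/
def rcost (f : Vec n → Vec m → Vec n) (ℓ : Vec n → Vec m → ℝ)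
    (h : Vec n → Vec m → Vec p) (ℓs : ℝ) (lam : Vec n → ℝ) (lb : Vec p)
    (x : Vec n) (u : ℕ → Vec m) (N : ℕ) : ℝ :=
  ∑ k ∈ Finset.range N, rot f ℓ h ℓs lam lb (traj f x u k) (u k)

/-- Rotated value function `J̃*_N(x,H)`. -/
def Jtstar (f : Vec n → Vec m → Vec n) (ℓ : Vec n → Vec m → ℝ)
    (h : Vec n → Vec m → Vec p) (Z : Set (Vec n × Vec m)) (T : ℕ)
    (ℓs : ℝ) (lam : Vec n → ℝ) (lb : Vec p) (N : ℕ)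
    (x : Vec n) (H : ℕ → Vec p) : ℝ :=
  sInf ((fun u => rcost f ℓ h ℓs lam lb x u N) '' {u | Admissible f h Z T N x H u})

/-- `k_{T,N} = ⌈N/T⌉·T − N`. -/
def kTN (T N : ℕ) : ℕ := ((N + T - 1) / T) * T - N

/-- The stored-output matrix along a trajectory, starting at time `d`
(column `k ∈ {1,…,T-1}` is the auxiliary output at time `d + k - 1`). -/
def storedH (f : Vec n → Vec m → Vec n) (h : Vec n → Vec m → Vec p)
    (x : Vec n) (u : ℕ → Vec m) (d : ℕ) : ℕ → Vec p :=
  fun k => h (traj f x u (d + k - 1)) (u (d + k - 1))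

/-- Local controllability (Assumption 4). -/
def LocCtrl (f : Vec n → Vec m → Vec n) (h : Vec n → Vec m → Vec p)
    (Z : Set (Vec n × Vec m)) (T : ℕ) (xs : Vec n) (δc Eh : ℝ) (d : ℕ)
    (γx γu : ℝ → ℝ) : Prop :=
  ∀ (xc : Vec n) (Hc : ℕ → Vec p) (uc : ℕ → Vec m),
    Admissible f h Z T (d + T) xc Hc uc →
    measH T Hc ≤ Eh →
    (∀ k ≤ d + T, ‖traj f xc uc k - xs‖ ≤ δc) →
    ∀ (N₁ : ℕ) (x₁ : Vec n) (H₁ : ℕ → Vec p) (u₁ : ℕ → Vec m),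
      d + T ≤ N₁ → x₁ ∈ Prod.fst '' Z → H₁ ∈ HSet h Z T →
      Admissible f h Z T N₁ x₁ H₁ u₁ →
      measH T (fun k => storedH f h x₁ u₁ d k - storedH f h xc uc d k) ≤ Eh →
      ‖traj f x₁ u₁ d - xs‖ ≤ δc →
      ∀ (x₂ : Vec n) (H₂ : ℕ → Vec p),
        ‖x₂ - xs‖ ≤ δc → measH T (fun k => H₂ k - Hc k) ≤ Eh →
        ∃ u₂ : ℕ → Vec m,
          Admissible f h Z T d x₂ H₂ u₂ ∧
          traj f x₂ u₂ d = traj f x₁ u₁ d ∧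
          Admissible f h Z T N₁ x₂ H₂ (fun k => if k < d then u₂ k else u₁ k) ∧
          ∀ k ≤ d,
            ‖traj f x₂ u₂ k - traj f xc uc k‖ ≤
              γx (max (‖x₂ - xc‖ + measH T (fun j => H₂ j - Hc j))
                (‖traj f x₁ u₁ d - traj f xc uc d‖ +
                  measH T (fun j => storedH f h x₁ u₁ d j - storedH f h xc uc d j))) ∧
            ‖u₂ k - uc k‖ ≤
              γu (max (‖x₂ - xc‖ + measH T (fun j => H₂ j - Hc j))
                (‖traj f x₁ u₁ d - traj f xc uc d‖ +
                  measH T (fun j => storedH f h x₁ u₁ d j - storedH f h xc uc d j)))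

/-- Shift dynamics of the stored outputs: `f_H(H, y) = [H_2, …, H_{T-1}, y]`. -/
def shiftH (T : ℕ) (H : ℕ → Vec p) (y : Vec p) : ℕ → Vec p :=
  fun k => if k + 1 < T then H (k + 1) else if k + 1 = T then y else H k

/-- Closed-loop trajectory of the extended state `χ = (x, H)` under the MPC
feedback `μ_N(x,H) = u*_{N,x,H}(0)`. -/
def clTraj (f : Vec n → Vec m → Vec n) (h : Vec n → Vec m → Vec p)
    (ustar : ℕ → Vec n → (ℕ → Vec p) → ℕ → Vec m) (N T : ℕ)
    (χ : Vec n × (ℕ → Vec p)) : ℕ → Vec n × (ℕ → Vec p)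
  | 0 => χ
  | k + 1 =>
    (f (clTraj f h ustar N T χ k).1
        (ustar N (clTraj f h ustar N T χ k).1 (clTraj f h ustar N T χ k).2 0),
      shiftH T (clTraj f h ustar N T χ k).2
        (h (clTraj f h ustar N T χ k).1
          (ustar N (clTraj f h ustar N T χ k).1 (clTraj f h ustar N T χ k).2 0)))


/-! ### Basic facts about trajectories -/

def cat (P : ℕ) (w g : ℕ → Vec m) : ℕ → Vec m := fun k => if k < P then w k else g (k - P)

lemma cat_lt {P : ℕ} {w g : ℕ → Vec m} {k : ℕ} (hk : k < P) : cat P w g k = w k := by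
  simp [cat, hk]

lemma cat_ge (P : ℕ) (w g : ℕ → Vec m) (k : ℕ) : cat P w g (P + k) = g k := by
  simp [cat]

lemma traj_congr (f : Vec n → Vec m → Vec n) (x : Vec n) {u v : ℕ → Vec m} {N : ℕ}
    (huv : ∀ k < N, u k = v k) : ∀ k ≤ N, traj f x u k = traj f x v k := by
  intro k
  induction k with
  | zero => intro _; rfl
  | succ k ih =>
    intro hk
    simp only [traj]
    rw [ih (by omega), huv k (by omega)]

lemma traj_shift (f : Vec n → Vec m → Vec n) (x : Vec n) (u : ℕ → Vec m) (P k : ℕ) :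
    traj f x u (P + k) = traj f (traj f x u P) (fun j => u (P + j)) k := by
  induction k with
  | zero => rfl
  | succ k ih =>
    rw [← Nat.add_assoc]
    simp only [traj]
    rw [ih]

lemma traj_cat_le (f : Vec n → Vec m → Vec n) (x : Vec n) (w g : ℕ → Vec m) {P k : ℕ}
    (hk : k ≤ P) : traj f x (cat P w g) k = traj f x w k :=
  traj_congr f x (fun _ hj => cat_lt hj) k hk

lemma traj_cat_ge (f : Vec n → Vec m → Vec n) (x : Vec n) (w g : ℕ → Vec m) (P k : ℕ) :
    traj f x (cat P w g) (P + k) = traj f (traj f x w P) g k := by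
  rw [traj_shift, traj_cat_le f x w g le_rfl]
  congr 1
  funext j
  exact cat_ge P w g j

lemma sum_stored (F : ℕ → ℝ) (T r j : ℕ) (hT : 1 ≤ T) :
    ∑ l ∈ Finset.Icc j (T - 1), F (r + 1 + l - 1) = ∑ k ∈ Finset.Ico (r + j) (r + T), F k := by
  have h1 : Finset.Icc j (T - 1) = Finset.Ico j T := by
    ext a; simp only [Finset.mem_Icc, Finset.mem_Ico]; omega
  rw [h1, add_comm r j, add_comm r T, ← Finset.sum_Ico_add' F j T r]
  apply Finset.sum_congr rfl
  intro l _
  congr 1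
  omega

/-- Tail of an admissible sequence, starting at time `T + r`. -/
lemma adm_tail (f : Vec n → Vec m → Vec n) (h : Vec n → Vec m → Vec p)
    (Z : Set (Vec n × Vec m)) {T N r : ℕ} (hT : 1 ≤ T) {x : Vec n} {H : ℕ → Vec p}
    {u : ℕ → Vec m} (hu : Admissible f h Z T N x H u) {N' : ℕ} (hN : T + r + N' = N)
    (hN' : T ≤ N') :
    Admissible f h Z T N' (traj f x u (T + r)) (storedH f h x u (r + 1))
      (fun k => u (T + r + k)) := by
  obtain ⟨h1, h2, h3⟩ := hu
  refine ⟨?_, ?_, ?_⟩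
  · intro k hk
    rw [← traj_shift]
    exact h1 _ (by omega)
  · intro j hj i
    rw [Finset.mem_Icc] at hj
    have e1 := sum_stored (fun k => h (traj f x u k) (u k) i) T r j hT
    have e2 : ∑ k ∈ Finset.range j, h (traj f (traj f x u (T + r))
        (fun k => u (T + r + k)) k) (u (T + r + k)) i
        = ∑ k ∈ Finset.Ico (r + T) (r + T + j), h (traj f x u k) (u k) i := by
      rw [Finset.sum_Ico_eq_sum_range]
      have : r + T + j - (r + T) = j := by omega
      rw [this]
      apply Finset.sum_congr rfl
      intro k _
      rw [← traj_shift, add_comm T r]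
    simp only [storedH]
    rw [e1, e2, Finset.sum_Ico_consecutive _ (by omega) (by omega)]
    have := h3 (r + j) (by omega) i
    rwa [show r + j + T = r + T + j by omega] at this
  · intro s hs i
    have := h3 (T + r + s) (by omega) i
    rw [Finset.sum_Ico_eq_sum_range] at this ⊢
    rw [show T + r + s + T - (T + r + s) = s + T - s by omega] at this
    refine le_of_eq_of_le (Finset.sum_congr rfl ?_) this
    intro k _
    rw [← traj_shift]
    simp only [add_assoc]

/-- Concatenation of admissible sequences at time `T + r`. -/
lemma adm_cat (f : Vec n → Vec m → Vec n) (h : Vec n → Vec m → Vec p)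
    (Z : Set (Vec n × Vec m)) {T N N' r : ℕ} (hT : 1 ≤ T) {x : Vec n} {H : ℕ → Vec p}
    {w g : ℕ → Vec m} (hw : Admissible f h Z T N x H w) (hN : T + r ≤ N)
    (hg : Admissible f h Z T N' (traj f x w (T + r)) (storedH f h x w (r + 1)) g) :
    Admissible f h Z T (T + r + N') x H (cat (T + r) w g) := by
  obtain ⟨h1, h2, h3⟩ := hw
  obtain ⟨g1, g2, g3⟩ := hg
  have hlo : ∀ k < T + r, ∀ i, h (traj f x (cat (T + r) w g) k) (cat (T + r) w g k) i
      = h (traj f x w k) (w k) i := by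
    intro k hk i
    rw [traj_cat_le f x w g hk.le, cat_lt hk]
  have hhi : ∀ k i, h (traj f x (cat (T + r) w g) (T + r + k)) (cat (T + r) w g (T + r + k)) i
      = h (traj f (traj f x w (T + r)) g k) (g k) i := by
    intro k i
    rw [traj_cat_ge, cat_ge]
  refine ⟨?_, ?_, ?_⟩
  · intro k hk
    by_cases hkP : k < T + r
    · rw [traj_cat_le f x w g hkP.le, cat_lt hkP]
      exact h1 k (by omega)
    · obtain ⟨q, rfl⟩ := Nat.exists_eq_add_of_le (not_lt.mp hkP)
      rw [traj_cat_ge, cat_ge]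
      exact g1 q (by omega)
  · intro j hj i
    have hj' := Finset.mem_Icc.mp hj
    refine le_of_eq_of_le ?_ (h2 j hj i)
    congr 1
    apply Finset.sum_congr rfl
    intro k hk
    rw [Finset.mem_range] at hk
    exact hlo k (by omega) i
  · intro s hs i
    rcases le_or_gt (s + T) (T + r) with hc | hc
    · refine le_of_eq_of_le ?_ (h3 s (by omega) i)
      apply Finset.sum_congr rfl
      intro k hk
      rw [Finset.mem_Ico] at hk
      exact hlo k (by omega) i
    rcases le_or_gt (T + r) s with hc2 | hc2
    · obtain ⟨q, rfl⟩ := Nat.exists_eq_add_of_le hc2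
      refine le_of_eq_of_le ?_ (g3 q (by omega) i)
      rw [Finset.sum_Ico_eq_sum_range, Finset.sum_Ico_eq_sum_range]
      rw [show T + r + q + T - (T + r + q) = q + T - q by omega]
      apply Finset.sum_congr rfl
      intro k _
      rw [add_assoc (T + r) q k]
      exact hhi _ i
    · obtain ⟨j, rfl⟩ : ∃ j, s = r + j := ⟨s - r, by omega⟩
      have hj : j ∈ Finset.Icc 1 (T - 1) := Finset.mem_Icc.mpr (by omega)
      refine le_of_eq_of_le ?_ (g2 j hj i)
      rw [← Finset.sum_Ico_consecutive _ (show r + j ≤ r + T by omega)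
        (show r + T ≤ r + j + T by omega)]
      congr 1
      · simp only [storedH]
        rw [sum_stored (fun k => h (traj f x w k) (w k) i) T r j hT]
        apply Finset.sum_congr rfl
        intro k hk
        rw [Finset.mem_Ico] at hk
        exact hlo k (by omega) i
      · rw [Finset.sum_Ico_eq_sum_range, show r + j + T - (r + T) = j by omega]
        apply Finset.sum_congr rfl
        intro k _
        rw [add_comm r T]
        exact hhi k i

/-- One-step tail of an admissible sequence for the shifted stored outputs. -/
lemma adm_step (f : Vec n → Vec m → Vec n) (h : Vec n → Vec m → Vec p)
    (Z : Set (Vec n × Vec m)) {T N : ℕ} (hT : 1 ≤ T) (hN : T ≤ N) {x : Vec n} {H : ℕ → Vec p}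
    {u : ℕ → Vec m} (hu : Admissible f h Z T (N + 1) x H u) :
    Admissible f h Z T N (f x (u 0)) (shiftH T H (h x (u 0))) (fun k => u (k + 1)) := by
  obtain ⟨h1, h2, h3⟩ := hu
  have ht : ∀ k, traj f (f x (u 0)) (fun k => u (k + 1)) k = traj f x u (k + 1) := by
    intro k
    have := traj_shift f x u 1 k
    rw [add_comm 1 k] at this
    rw [this]
    simp only [traj]
    congr 1
    funext j
    rw [add_comm]
  refine ⟨?_, ?_, ?_⟩
  · intro k hk
    rw [ht]
    exact h1 _ (by omega)
  · intro j hj i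
    have hj' := Finset.mem_Icc.mp hj
    have e1 : ∑ l ∈ Finset.Icc j (T - 1), shiftH T H (h x (u 0)) l i
        = ∑ l ∈ Finset.Icc (j + 1) (T - 1), H l i + h x (u 0) i := by
      have a1 : Finset.Icc j (T - 1) = Finset.Ico j (T - 1 + 1) := by
        ext a; simp only [Finset.mem_Icc, Finset.mem_Ico]; omega
      have a2 : Finset.Icc (j + 1) (T - 1) = Finset.Ico (j + 1) (T - 1 + 1) := by
        ext a; simp only [Finset.mem_Icc, Finset.mem_Ico]; omega
      rw [a1, a2, Finset.sum_Ico_succ_top (by omega), ← Finset.sum_Ico_add']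
      congr 1
      · apply Finset.sum_congr rfl
        intro l hl
        rw [Finset.mem_Ico] at hl
        simp only [shiftH]
        rw [if_pos (by omega)]
      · simp only [shiftH]
        rw [if_neg (by omega), if_pos (by omega)]
    have e2 : ∑ k ∈ Finset.range (j + 1), h (traj f x u k) (u k) i
        = ∑ k ∈ Finset.range j, h (traj f x u (k + 1)) (u (k + 1)) i + h x (u 0) i := by
      rw [Finset.sum_range_succ']
      rfl
    have e3 : ∑ l ∈ Finset.Icc (j + 1) (T - 1), H l i +
        ∑ k ∈ Finset.range (j + 1), h (traj f x u k) (u k) i ≤ 0 := by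
      by_cases hjT : j + 1 ≤ T - 1
      · exact h2 (j + 1) (Finset.mem_Icc.mpr (by omega)) i
      · rw [Finset.Icc_eq_empty (by omega), Finset.sum_empty, zero_add]
        have := h3 0 (by omega) i
        rw [show j + 1 = T by omega]
        simpa using this
    simp only [ht]
    rw [e1]
    linarith
  · intro s hs i
    have := h3 (s + 1) (by omega) i
    rw [Finset.sum_Ico_eq_sum_range] at this ⊢
    rw [show s + 1 + T - (s + 1) = s + T - s by omega] at this
    refine le_of_eq_of_le (Finset.sum_congr rfl ?_) this
    intro k _
    have hsk : s + k + 1 = s + 1 + k := by omega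
    simp only [ht, hsk]

lemma cost_step (f : Vec n → Vec m → Vec n) (ℓ : Vec n → Vec m → ℝ) (x : Vec n)
    (u : ℕ → Vec m) (N : ℕ) :
    cost f ℓ x u (N + 1) = cost f ℓ (f x (u 0)) (fun k => u (k + 1)) N + ℓ x (u 0) := by
  have ht : ∀ k, traj f (f x (u 0)) (fun k => u (k + 1)) k = traj f x u (k + 1) := by
    intro k
    have := traj_shift f x u 1 k
    rw [add_comm 1 k] at this
    rw [this]
    simp only [traj]
    congr 1
    funext j
    rw [add_comm]
  simp only [cost, ht]
  rw [Finset.sum_range_succ']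
  rfl

/-- Sums of the auxiliary output over full periods are nonpositive. -/
lemma sum_h_nonpos (f : Vec n → Vec m → Vec n) (h : Vec n → Vec m → Vec p)
    (Z : Set (Vec n × Vec m)) {T N : ℕ} {x : Vec n} {H : ℕ → Vec p}
    {u : ℕ → Vec m} (hu : Admissible f h Z T N x H u) (q : ℕ) (hq : T * q ≤ N) (i : Fin p) :
    ∑ k ∈ Finset.range (T * q), h (traj f x u k) (u k) i ≤ 0 := by
  induction q with
  | zero => simp
  | succ q ih =>
    have h0 : T * (q + 1) = T * q + T := by ring
    rw [h0] at hq ⊢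
    have h1 := hu.2.2 (T * q) hq i
    have h2 := ih (by omega)
    rw [Finset.range_eq_Ico] at h2 ⊢
    rw [← Finset.sum_Ico_consecutive _ (Nat.zero_le _) (Nat.le_add_right _ _)]
    linarith

/-- Multiplier-weighted sums. -/
lemma sum_lb_nonpos (f : Vec n → Vec m → Vec n) (h : Vec n → Vec m → Vec p)
    (Z : Set (Vec n × Vec m)) {T N : ℕ} {x : Vec n} {H : ℕ → Vec p} {lb : Vec p}
    (hlb : ∀ i, 0 ≤ lb i)
    {u : ℕ → Vec m} (hu : Admissible f h Z T N x H u) (q : ℕ) (hq : T * q ≤ N) :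
    ∑ k ∈ Finset.range (T * q), ∑ i, lb i * h (traj f x u k) (u k) i ≤ 0 := by
  rw [Finset.sum_comm]
  apply Finset.sum_nonpos
  intro i _
  rw [← Finset.mul_sum]
  exact mul_nonpos_of_nonneg_of_nonpos (hlb i) (sum_h_nonpos f h Z hu q hq i)

lemma sum_lb_le (f : Vec n → Vec m → Vec n) (h : Vec n → Vec m → Vec p)
    (Z : Set (Vec n × Vec m)) {T N : ℕ} (hT : 1 ≤ T) {x : Vec n} {H : ℕ → Vec p} {lb : Vec p}
    (hlb : ∀ i, 0 ≤ lb i) {B : ℝ} (hB0 : 0 ≤ B) (hB : ∀ z ∈ Z, ∑ i, lb i * h z.1 z.2 i ≤ B)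
    {u : ℕ → Vec m} (hu : Admissible f h Z T N x H u) (M : ℕ) (hM : M ≤ N) :
    ∑ k ∈ Finset.range M, ∑ i, lb i * h (traj f x u k) (u k) i ≤ T * B := by
  have hd := Nat.div_add_mod M T
  have hlt := Nat.mod_lt M (show T > 0 by omega)
  have h1 := sum_lb_nonpos f h Z hlb hu (M / T) (by omega)
  rw [← hd, Finset.sum_range_add]
  have h2 : ∑ k ∈ Finset.range (M % T), ∑ i, lb i * h (traj f x u (T * (M / T) + k))
      (u (T * (M / T) + k)) i ≤ ∑ k ∈ Finset.range (M % T), B := by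
    apply Finset.sum_le_sum
    intro k hk
    rw [Finset.mem_range] at hk
    exact hB _ (hu.1 _ (by omega))
  rw [Finset.sum_const, Finset.card_range, nsmul_eq_mul] at h2
  have h3 : ((M % T : ℕ) : ℝ) * B ≤ T * B :=
    mul_le_mul_of_nonneg_right (by exact_mod_cast hlt.le) hB0
  linarith

lemma rcost_eq (f : Vec n → Vec m → Vec n) (ℓ : Vec n → Vec m → ℝ)
    (h : Vec n → Vec m → Vec p) (ℓs : ℝ) (lam : Vec n → ℝ) (lb : Vec p)
    (x : Vec n) (u : ℕ → Vec m) (N : ℕ) :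
    rcost f ℓ h ℓs lam lb x u N = cost f ℓ x u N - N * ℓs + lam x - lam (traj f x u N)
      + ∑ k ∈ Finset.range N, ∑ i, lb i * h (traj f x u k) (u k) i := by
  induction N with
  | zero => simp [rcost, cost, traj]
  | succ N ih =>
    simp only [rcost, cost] at ih ⊢
    rw [Finset.sum_range_succ, ih, Finset.sum_range_succ _ N, Finset.sum_range_succ _ N]
    simp only [rot, traj]
    push_cast
    ring

/-! ### Analytic helper lemmas -/

lemma KInf.small {α : ℝ → ℝ} (hα : KInf α) {η : ℝ} (hη : 0 < η) :
    ∃ ε > 0, ∀ r, 0 ≤ r → r ≤ ε → α r ≤ η := by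
  obtain ⟨hc, _, h0, _⟩ := hα
  have h1 := hc 0 (Set.mem_Ici.mpr le_rfl)
  rw [Metric.continuousWithinAt_iff] at h1
  obtain ⟨δ, hδ, h2⟩ := h1 η hη
  refine ⟨δ / 2, by positivity, ?_⟩
  intro r hr hr2
  have h3 := h2 (Set.mem_Ici.mpr hr) (by
    rw [Real.dist_eq, sub_zero, abs_of_nonneg hr]; linarith)
  rw [Real.dist_eq, h0, sub_zero] at h3
  exact (le_abs_self _).trans h3.le

lemma KInf.mono {α : ℝ → ℝ} (hα : KInf α) {a b : ℝ} (ha : 0 ≤ a) (hab : a ≤ b) : α a ≤ α b :=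
  hα.2.1.monotoneOn (Set.mem_Ici.mpr ha) (Set.mem_Ici.mpr (ha.trans hab)) hab

lemma KInf.nonneg {α : ℝ → ℝ} (hα : KInf α) {a : ℝ} (ha : 0 ≤ a) : 0 ≤ α a := by
  have := hα.mono le_rfl ha
  rwa [hα.2.2.1] at this

lemma KInf.pos {α : ℝ → ℝ} (hα : KInf α) {a : ℝ} (ha : 0 < a) : 0 < α a := by
  have := hα.2.1 (Set.mem_Ici.mpr le_rfl) (Set.mem_Ici.mpr ha.le) ha
  rwa [hα.2.2.1] at this

/-- Partial sums of a `KLS` function are uniformly bounded on bounded sets. -/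
lemma KLS.sum_le {β : ℝ → ℕ → ℝ} (hβ : KLS β) {r R : ℝ} (hr : 0 ≤ r) (hrR : r ≤ R) (N : ℕ) :
    ∑ k ∈ Finset.range N, β r k ≤ ∑' k, β R k := by
  have h1 : ∑ k ∈ Finset.range N, β r k ≤ ∑' k, β r k :=
    (hβ.2.2.1 r hr).sum_le_tsum _ (fun k _ => (hβ.2.1 r hr).2.1 k)
  refine h1.trans ?_
  exact hβ.2.2.2.2.1.monotoneOn (Set.mem_Ici.mpr hr) (Set.mem_Ici.mpr (hr.trans hrR)) hrR

lemma measH_nonneg (T : ℕ) (H : ℕ → Vec p) : 0 ≤ measH T H := by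
  apply Real.iSup_nonneg
  intro k
  apply Real.iSup_nonneg
  intro _
  exact Finset.sum_nonneg (fun i _ => le_max_right _ _)

lemma measH_le {T : ℕ} {H : ℕ → Vec p} {b : ℝ} (hb : 0 ≤ b)
    (hH : ∀ k, 1 ≤ k → k < T → ∀ i, H k i ≤ b) : measH T H ≤ p * b := by
  have hpb : (0 : ℝ) ≤ p * b := by positivity
  apply Real.iSup_le _ hpb
  intro k
  apply Real.iSup_le _ hpb
  intro hk
  rw [Finset.mem_Icc] at hk
  have : hatCol H k ≤ ∑ i : Fin p, b := by
    apply Finset.sum_le_sum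
    intro i _
    exact max_le (hH k hk.1 (by omega) i) hb
  simpa using this

/-- Construction of an `L_ℕ` bound. -/
lemma exists_LN (Q : ℕ → ℝ → Prop) (c : ℕ)
    (hQ : ∀ ε > 0, ∃ N0, ∀ N ≥ N0, Q N ε)
    (hcl : ∀ N a, (∀ ε > a, Q N ε) → Q N a) (hmono : ∀ N a b, a ≤ b → Q N a → Q N b) :
    ∃ (N0 : ℕ) (σ : ℕ → ℝ), LN σ ∧ ∀ N ≥ N0, Q N (σ (N - c)) := by
  let S : ℕ → Set ℝ := fun k => {ε | 0 ≤ ε ∧ ∀ N ≥ k + c, Q N ε} ∪ {1}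
  have hSn : ∀ k, (S k).Nonempty := fun k => ⟨1, Or.inr rfl⟩
  have hSp : ∀ k, ∀ ε ∈ S k, 0 ≤ ε := by
    rintro k ε (h | h)
    · exact h.1
    · rw [Set.mem_singleton_iff] at h; rw [h]; norm_num
  have hSb : ∀ k, BddBelow (S k) := fun k => ⟨0, fun ε hε => hSp k ε hε⟩
  obtain ⟨N1, hN1⟩ := hQ 1 one_pos
  refine ⟨max N1 c, fun k => sInf (S k), ⟨?_, ?_, ?_⟩, ?_⟩
  · intro k k' hk
    apply csInf_le_csInf (hSb k') (hSn k)
    rintro ε (h | h)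
    · exact Or.inl ⟨h.1, fun N hN => h.2 N (by omega)⟩
    · exact Or.inr h
  · intro k
    exact le_csInf (hSn k) (hSp k)
  · rw [Metric.tendsto_atTop]
    intro ε hε
    obtain ⟨N0, hN0⟩ := hQ (ε / 2) (by positivity)
    refine ⟨N0, fun k hk => ?_⟩
    have h1 : sInf (S k) ≤ ε / 2 :=
      csInf_le (hSb k) (Or.inl ⟨by positivity, fun N hN => hN0 N (by omega)⟩)
    have h2 : 0 ≤ sInf (S k) := le_csInf (hSn k) (hSp k)
    rw [Real.dist_eq, sub_zero, abs_of_nonneg h2]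
    linarith
  · intro N hN
    apply hcl
    intro ε hε
    obtain ⟨a, ha, haε⟩ := exists_lt_of_csInf_lt (hSn _) hε
    apply hmono N a ε haε.le
    rcases ha with ha | ha
    · exact ha.2 N (by omega)
    · rw [Set.mem_singleton_iff] at ha
      rw [ha]
      exact hN1 N (le_trans (le_max_left _ _) hN)

/-- Pigeonhole: a small set misses some block. -/
lemma exists_block (A : Finset ℕ) (B L : ℕ) (hA : A.card ≤ B) :
    ∃ j ≤ B, ∀ k, j * L ≤ k → k < (j + 1) * L → k ∉ A := by
  by_contra hcon
  push Not at hcon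
  have hsub : Finset.range (B + 1) ⊆ A.image (fun k => k / L) := by
    intro j hj
    rw [Finset.mem_range] at hj
    obtain ⟨k, hk1, hk2, hk3⟩ := hcon j (by omega)
    rw [Finset.mem_image]
    exact ⟨k, hk3, Nat.div_eq_of_lt_le hk1 hk2⟩
  have h1 := Finset.card_le_card hsub
  have h2 : (A.image (fun k => k / L)).card ≤ A.card := Finset.card_image_le
  rw [Finset.card_range] at h1
  omega

/-- A window where two sequences with bounded `ρ`-sums are both small. -/
lemma exists_window {ρ : ℝ → ℝ} (hρ : KInf ρ) (C : ℝ) (L : ℕ) {ε : ℝ} (hε : 0 < ε) :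
    ∃ M0 : ℕ, ∀ M ≥ M0, ∀ a b : ℕ → ℝ, (∀ k, 0 ≤ a k) → (∀ k, 0 ≤ b k) →
      ∑ k ∈ Finset.range M, ρ (a k) ≤ C → ∑ k ∈ Finset.range M, ρ (b k) ≤ C →
      ∃ j, (j + 1) * L ≤ M ∧ ∀ k, j * L ≤ k → k < (j + 1) * L → a k ≤ ε ∧ b k ≤ ε := by
  obtain ⟨B, hB⟩ := exists_nat_ge (2 * C / ρ ε)
  have hρε := hρ.pos hε
  rw [div_le_iff₀ hρε] at hB
  refine ⟨(B + 1) * L, fun M hM a b ha hb hsa hsb => ?_⟩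
  set A := (Finset.range M).filter (fun k => ε < a k ∨ ε < b k) with hAdef
  have h1 : (A.card : ℝ) * ρ ε ≤ 2 * C := by
    calc (A.card : ℝ) * ρ ε = ∑ k ∈ A, ρ ε := by rw [Finset.sum_const, nsmul_eq_mul]
      _ ≤ ∑ k ∈ A, (ρ (a k) + ρ (b k)) := by
        apply Finset.sum_le_sum
        intro k hk
        rw [hAdef, Finset.mem_filter] at hk
        have e1 := hρ.nonneg (ha k)
        have e2 := hρ.nonneg (hb k)
        rcases hk.2 with h | h
        · have := hρ.mono hε.le h.le
          linarith
        · have := hρ.mono hε.le h.le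
          linarith
      _ ≤ ∑ k ∈ Finset.range M, (ρ (a k) + ρ (b k)) := by
        apply Finset.sum_le_sum_of_subset_of_nonneg (Finset.filter_subset _ _)
        intro k _ _
        exact add_nonneg (hρ.nonneg (ha k)) (hρ.nonneg (hb k))
      _ ≤ 2 * C := by rw [Finset.sum_add_distrib]; linarith
  have h2 : A.card ≤ B := by
    have : (A.card : ℝ) ≤ B := le_of_mul_le_mul_right (h1.trans hB) hρε
    exact_mod_cast this
  obtain ⟨j, hj, hjk⟩ := exists_block A B L h2
  have h3 : (j + 1) * L ≤ M := le_trans (Nat.mul_le_mul_right L (by omega)) hM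
  refine ⟨j, h3, fun k hk1 hk2 => ?_⟩
  have := hjk k hk1 hk2
  rw [hAdef, Finset.mem_filter, Finset.mem_range] at this
  push Not at this
  exact this (by omega)

lemma coord_le_norm (v : Vec p) (i : Fin p) : |v i| ≤ ‖v‖ := by
  have := PiLp.norm_apply_le v i
  simpa using this

/-- Splicing two admissible trajectories near the steady state. -/
lemma splice (f : Vec n → Vec m → Vec n) (h : Vec n → Vec m → Vec p)
    (Z : Set (Vec n × Vec m)) {T : ℕ} (hT : 1 ≤ T) {Lh : ℝ} {xs : Vec n} {us : Vec m}
    {δc Eh : ℝ} {d : ℕ} {γx γu : ℝ → ℝ} (hLh : 0 < Lh)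
    (hhL : ∀ z₁ ∈ Z, ∀ z₂ ∈ Z,
      ‖h z₁.1 z₁.2 - h z₂.1 z₂.2‖ ≤ Lh * ‖(z₁.1 - z₂.1, z₁.2 - z₂.2)‖)
    (hzs : (xs, us) ∈ Z) (hfix : f xs us = xs) (hhs : ∀ i, h xs us i ≤ 0)
    (hbd : ∀ z ∈ Z, ∀ i, sInf ((fun z : Vec n × Vec m => h z.1 z.2 i) '' Z) ≤ h z.1 z.2 i ∧
      h z.1 z.2 i ≤ sSup ((fun z : Vec n × Vec m => h z.1 z.2 i) '' Z))
    (hδc : 0 < δc) (hEh : 0 < Eh) (hγx : KInf γx) (hγu : KInf γu)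
    (hloc : LocCtrl f h Z T xs δc Eh d γx γu) {η : ℝ} (hη : 0 < η) :
    ∃ ε > 0, ∀ (x x' : Vec n) (H H' : ℕ → Vec p) (w w' : ℕ → Vec m) (N r r' R : ℕ),
      Admissible f h Z T N x H w → Admissible f h Z T (T + r' + (d + (T + R))) x' H' w' →
      T + r < N →
      (∀ k, r ≤ k → k ≤ T + r → ‖(traj f x w k - xs, w k - us)‖ ≤ ε) →
      (∀ k, T + r' + d ≤ k → k < T + r' + d + T → ‖(traj f x' w' k - xs, w' k - us)‖ ≤ ε) →
      ∃ v : ℕ → Vec m, Admissible f h Z T (T + r + (d + (T + R))) x H v ∧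
        (∀ k < T + r, traj f x v k = traj f x w k ∧ v k = w k) ∧
        (∀ k < d, ‖(traj f x v (T + r + k) - xs, v (T + r + k) - us)‖ ≤ η) ∧
        (∀ k, traj f x v (T + r + d + k) = traj f x' w' (T + r' + d + k) ∧
          v (T + r + d + k) = w' (T + r' + d + k)) := by
  obtain ⟨ε1, hε1, hx1⟩ := hγx.small hη
  obtain ⟨ε2, hε2, hu1⟩ := hγu.small hη
  set c : ℝ := 1 + p * Lh with hc
  have hcpos : 0 < c := by positivity
  set b : ℝ := min (min ε1 ε2) (min δc Eh) with hb
  have hbpos : 0 < b := by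
    rw [hb]; exact lt_min (lt_min hε1 hε2) (lt_min hδc hEh)
  have hb1 : b ≤ ε1 := (min_le_left _ _).trans (min_le_left _ _)
  have hb2 : b ≤ ε2 := (min_le_left _ _).trans (min_le_right _ _)
  have hb3 : b ≤ δc := (min_le_right _ _).trans (min_le_left _ _)
  have hb4 : b ≤ Eh := (min_le_right _ _).trans (min_le_right _ _)
  refine ⟨b / c, by positivity, ?_⟩
  intro x x' H H' w w' N r r' R hw hw' hN hnw hnw'
  set ε := b / c with hε
  have hεpos : 0 < ε := by positivity
  have hεc : ε + p * (Lh * ε) = b := by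
    have : ε * c = b := div_mul_cancel₀ b hcpos.ne'
    rw [← this, hc]; ring
  have hεb : ε ≤ b := by
    have : 0 ≤ p * (Lh * ε) := by positivity
    linarith
  have hMb : p * (Lh * ε) ≤ b := by linarith
  -- reference: the steady state
  have hts : ∀ k, traj f xs (fun _ => us) k = xs := by
    intro k
    induction k with
    | zero => rfl
    | succ k ih => simp only [traj]; rw [ih, hfix]
  have href : Admissible f h Z T (d + T) xs (fun _ => h xs us) (fun _ => us) := by
    refine ⟨?_, ?_, ?_⟩
    · intro k _
      rw [hts]; exact hzs
    · intro j _ i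
      simp only [hts]
      exact add_nonpos (Finset.sum_nonpos fun _ _ => hhs i) (Finset.sum_nonpos fun _ _ => hhs i)
    · intro s _ i
      simp only [hts]
      exact Finset.sum_nonpos fun _ _ => hhs i
  have hrefH : measH T (fun _ : ℕ => h xs us) ≤ Eh := by
    have : measH T (fun _ : ℕ => h xs us) ≤ p * 0 := measH_le le_rfl (fun _ _ _ i => hhs i)
    rw [mul_zero] at this
    linarith
  -- closeness of outputs
  have hout : ∀ z ∈ Z, ‖(z.1 - xs, z.2 - us)‖ ≤ ε → ∀ i, (h z.1 z.2 - h xs us) i ≤ Lh * ε := by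
    intro z hz hze i
    have h1 := hhL z hz (xs, us) hzs
    have h2 := coord_le_norm (h z.1 z.2 - h xs us) i
    have h3 : Lh * ‖(z.1 - xs, z.2 - us)‖ ≤ Lh * ε := mul_le_mul_of_nonneg_left hze hLh.le
    exact (le_abs_self _).trans (h2.trans (h1.trans h3))
  have hst : ∀ a : Vec n, ∀ g : Vec m, ‖(a - xs, g - us)‖ ≤ ε → ‖a - xs‖ ≤ ε := by
    intro a g hag
    exact (norm_fst_le (a - xs, g - us)).trans hag
  have hH2 : measH T (fun k => storedH f h x w (r + 1) k - h xs us) ≤ p * (Lh * ε) := by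
    apply measH_le (by positivity)
    intro k hk1 hk2 i
    have he : r + 1 + k - 1 = r + k := by omega
    simp only [storedH, he]
    exact hout (_, _) (hw.1 (r + k) (by omega)) (hnw (r + k) (by omega) (by omega)) i
  have hx2 := hst _ _ (hnw (T + r) (by omega) le_rfl)
  -- the trajectory to be joined
  have hw1 := adm_tail f h Z hT hw' rfl (show T ≤ d + (T + R) by omega)
  have hH3 : measH T (fun k => storedH f h (traj f x' w' (T + r')) (fun k => w' (T + r' + k)) d k
      - storedH f h xs (fun _ => us) d k) ≤ p * (Lh * ε) := by
    apply measH_le (by positivity)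
    intro k hk1 hk2 i
    have he : d + k - 1 = d + (k - 1) := by omega
    simp only [storedH, he, hts]
    rw [← traj_shift]
    exact hout (_, _) (hw'.1 _ (by omega)) (hnw' _ (by omega) (by omega)) i
  have hx3 : ‖traj f (traj f x' w' (T + r')) (fun k => w' (T + r' + k)) d - xs‖ ≤ ε := by
    rw [← traj_shift]
    exact hst _ _ (hnw' (T + r' + d) le_rfl (by omega))
  have hx1Z : traj f x' w' (T + r') ∈ Prod.fst '' Z := ⟨_, hw'.1 (T + r') (by omega), rfl⟩
  have hH1 : storedH f h x' w' (r' + 1) ∈ HSet h Z T := by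
    intro k hk i
    rw [Finset.mem_Icc] at hk
    exact hbd (_, _) (hw'.1 (r' + 1 + k - 1) (by omega)) i
  obtain ⟨u₂, -, hu2b, hu2c, hu2d⟩ := hloc xs (fun _ => h xs us) (fun _ => us) href hrefH
    (by intro k _; rw [hts, sub_self, norm_zero]; exact hδc.le)
    (d + (T + R)) (traj f x' w' (T + r')) (storedH f h x' w' (r' + 1))
    (fun k => w' (T + r' + k)) (by omega) hx1Z hH1 hw1 (by linarith) (by linarith)
    (traj f x w (T + r)) (storedH f h x w (r + 1)) (by linarith) (by linarith)
  set g : ℕ → Vec m := fun k => if k < d then u₂ k else w' (T + r' + k) with hg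
  have hgtraj : ∀ k ≤ d, traj f (traj f x w (T + r)) g k = traj f (traj f x w (T + r)) u₂ k :=
    traj_congr f _ (fun k hk => by simp [hg, hk])
  have hghi : ∀ k, g (d + k) = w' (T + r' + d + k) := by
    intro k
    simp only [hg]
    rw [if_neg (by omega), ← add_assoc]
  refine ⟨cat (T + r) w g, adm_cat f h Z hT hw hN.le hu2c, ?_, ?_, ?_⟩
  · intro k hk
    exact ⟨traj_cat_le f x w g hk.le, cat_lt hk⟩
  · intro k hk
    rw [traj_cat_ge, cat_ge, hgtraj k hk.le]
    have hgk : g k = u₂ k := by simp [hg, hk]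
    rw [hgk]
    have hζ0 := hu2d k hk.le
    simp only [hts] at hζ0
    have hz : max (‖traj f x w (T + r) - xs‖ +
          measH T (fun j => storedH f h x w (r + 1) j - h xs us))
        (‖traj f (traj f x' w' (T + r')) (fun k => w' (T + r' + k)) d - xs‖ +
          measH T (fun k => storedH f h (traj f x' w' (T + r')) (fun k => w' (T + r' + k)) d k
            - storedH f h xs (fun _ => us) d k)) ≤ b :=
      max_le (by linarith) (by linarith)
    have hz0 : 0 ≤ max (‖traj f x w (T + r) - xs‖ +
          measH T (fun j => storedH f h x w (r + 1) j - h xs us))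
        (‖traj f (traj f x' w' (T + r')) (fun k => w' (T + r' + k)) d - xs‖ +
          measH T (fun k => storedH f h (traj f x' w' (T + r')) (fun k => w' (T + r' + k)) d k
            - storedH f h xs (fun _ => us) d k)) :=
      le_max_of_le_left (add_nonneg (norm_nonneg _) (measH_nonneg _ _))
    rw [Prod.norm_def]
    exact max_le (hζ0.1.trans (hx1 _ hz0 (hz.trans hb1)))
      (hζ0.2.trans (hu1 _ hz0 (hz.trans hb2)))
  · intro k
    rw [add_assoc (T + r) d k, traj_cat_ge, cat_ge]
    refine ⟨?_, by rw [hghi]⟩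
    rw [traj_shift f _ g d k, hgtraj d le_rfl, hu2b, ← traj_shift, traj_shift f x' w' _ k]
    congr 1
    funext j
    exact hghi j

/-- Splitting of the cost of a spliced trajectory. -/
lemma sum_splice (a b b' : ℕ → ℝ) (P P' d S : ℕ) (h1 : ∀ k < P, a k = b k)
    (h3 : ∀ k, a (P + d + k) = b' (P' + d + k)) :
    ∑ k ∈ Finset.range (P + (d + S)), a k = ∑ k ∈ Finset.range P, b k
      + ∑ k ∈ Finset.range d, a (P + k) + ∑ k ∈ Finset.range (P' + (d + S)), b' k
      - ∑ k ∈ Finset.range P', b' k - ∑ k ∈ Finset.range d, b' (P' + k) := by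
  rw [← add_assoc P, ← add_assoc P', Finset.sum_range_add a (P + d) S, Finset.sum_range_add a P d,
    Finset.sum_range_add b' (P' + d) S, Finset.sum_range_add b' P' d,
    Finset.sum_congr rfl (fun k hk => h1 k (Finset.mem_range.mp hk)),
    Finset.sum_congr rfl (fun k _ => h3 k)]
  ring

lemma sum_near (a : ℕ → ℝ) (d : ℕ) (c η : ℝ) (ha : ∀ k < d, |a k - c| ≤ η) :
    |∑ k ∈ Finset.range d, a k - d * c| ≤ d * η := by
  have h1 : ∑ k ∈ Finset.range d, a k - d * c = ∑ k ∈ Finset.range d, (a k - c) := by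
    rw [Finset.sum_sub_distrib, Finset.sum_const, Finset.card_range, nsmul_eq_mul]
  rw [h1]
  refine (Finset.abs_sum_le_sum_abs _ _).trans ?_
  calc ∑ k ∈ Finset.range d, |a k - c| ≤ ∑ k ∈ Finset.range d, η :=
        Finset.sum_le_sum fun k hk => ha k (Finset.mem_range.mp hk)
    _ = d * η := by rw [Finset.sum_const, Finset.card_range, nsmul_eq_mul]

/-- The window lemma in the form used below. -/
lemma exists_window' {ρ : ℝ → ℝ} (hρ : KInf ρ) (C : ℝ) (T d : ℕ) (hT : 1 ≤ T)
    {ε : ℝ} (hε : 0 < ε) :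
    ∃ M0 : ℕ, ∀ M ≥ M0, ∀ a b : ℕ → ℝ, (∀ k, 0 ≤ a k) → (∀ k, 0 ≤ b k) →
      ∑ k ∈ Finset.range M, ρ (a k) ≤ C → ∑ k ∈ Finset.range M, ρ (b k) ≤ C →
      ∃ r q R, T + (r + 1) = T * q ∧ M + 1 = T + (r + 1) + (d + (T + (R + 1))) ∧
        ∀ k, r ≤ k → k ≤ T + (r + 1) + d + T → a k ≤ ε ∧ b k ≤ ε := by
  obtain ⟨M0, hM0⟩ := exists_window hρ C (T * (d + 4)) hε
  refine ⟨M0, fun M hM a b ha hb hsa hsb => ?_⟩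
  obtain ⟨j, hj, hjk⟩ := hM0 M hM a b ha hb hsa hsb
  have e1 : (j + 1) * (T * (d + 4)) = j * (T * (d + 4)) + (T * d + 4 * T) := by ring
  have e2 : d ≤ T * d := Nat.le_mul_of_pos_left d hT
  rw [e1] at hj hjk
  refine ⟨j * (T * (d + 4)) + T - 1, j * (d + 4) + 2,
    M - (j * (T * (d + 4)) + T + T + d + T), ?_, ?_, ?_⟩
  · rw [show T * (j * (d + 4) + 2) = j * (T * (d + 4)) + 2 * T by ring]
    omega
  · omega
  · intro k hk1 hk2
    exact hjk k (by omega) (by omega)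

set_option maxHeartbeats 1000000

theorem closed_loop_performance (n m p T : ℕ) (hT : 1 ≤ T)
    (f : Vec n → Vec m → Vec n) (ℓ : Vec n → Vec m → ℝ)
    (h : Vec n → Vec m → Vec p) (Z : Set (Vec n × Vec m)) (Lh : ℝ)
    (xs : Vec n) (us : Vec m) (lam : Vec n → ℝ) (lb : Vec p) (ρ : ℝ → ℝ)
    (δc Eh : ℝ) (d : ℕ) (γx γu : ℝ → ℝ) (ψb : ℝ → ℝ)
    (ustar tust : ℕ → Vec n → (ℕ → Vec p) → ℕ → Vec m)
    -- Assumption 1 (compactness and continuity)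
    (hZ : IsCompact Z)
    (hfc : ∃ αf : ℝ → ℝ, KInf αf ∧ ∀ z₁ ∈ Z, ∀ z₂ ∈ Z,
      ‖f z₁.1 z₁.2 - f z₂.1 z₂.2‖ ≤ αf ‖(z₁.1 - z₂.1, z₁.2 - z₂.2)‖)
    (halc : ∃ αl : ℝ → ℝ, KInf αl ∧ ∀ z₁ ∈ Z, ∀ z₂ ∈ Z,
      |ℓ z₁.1 z₁.2 - ℓ z₂.1 z₂.2| ≤ αl ‖(z₁.1 - z₂.1, z₁.2 - z₂.2)‖)
    (hLh : 0 < Lh)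
    (hhL : ∀ z₁ ∈ Z, ∀ z₂ ∈ Z,
      ‖h z₁.1 z₁.2 - h z₂.1 z₂.2‖ ≤ Lh * ‖(z₁.1 - z₂.1, z₁.2 - z₂.2)‖)
    -- optimal steady-state
    (hzs : (xs, us) ∈ Z) (hfix : f xs us = xs) (hhs : ∀ i, h xs us i ≤ 0)
    -- Assumption 2 (strict dissipativity)
    (hρ : KInf ρ) (hlb : ∀ i, 0 ≤ lb i) (hlam0 : lam xs = 0)
    (hlamc : ∃ αlam : ℝ → ℝ, KInf αlam ∧ ∀ x₁ ∈ Prod.fst '' Z, ∀ x₂ ∈ Prod.fst '' Z,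
      |lam x₁ - lam x₂| ≤ αlam ‖x₁ - x₂‖)
    (hdiss : ∀ z ∈ Z, lam (f z.1 z.2) - lam z.1 ≤
      ℓ z.1 z.2 - ℓ xs us + (∑ i, lb i * h z.1 z.2 i) - ρ ‖(z.1 - xs, z.2 - us)‖)
    -- Assumption 3 (asymptotic controllability)
    (hac : ∃ β₁ β₂ : ℝ → ℕ → ℝ, KLS β₁ ∧ KLS β₂ ∧
      ∀ x ∈ Prod.fst '' Z, ∀ H ∈ HSet h Z T, ∀ N : ℕ, ∃ u : ℕ → Vec m,
        Admissible f h Z T N x H u ∧ ∀ k < N,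
          ℓ (traj f x u k) (u k) - ℓ xs us ≤
            β₁ ‖x - xs‖ k + β₂ (measH T (fun j => H j - h xs us)) k ∧
          rot f ℓ h (ℓ xs us) lam lb (traj f x u k) (u k) ≤
            β₁ ‖x - xs‖ k + β₂ (measH T (fun j => H j - h xs us)) k)
    -- Assumption 4 (local controllability)
    (hδc : 0 < δc) (hEh : 0 < Eh) (hdT : T ≤ d) (hγx : KInf γx) (hγu : KInf γu)
    (hloc : LocCtrl f h Z T xs δc Eh d γx γu)
    -- Assumption 5
    (hψb : KInf ψb)
    (hψ : ∀ kψ : ℕ, T - 1 ≤ kψ → ∀ N : ℕ, ∀ x ∈ Prod.fst '' Z, ∀ H ∈ HSet h Z T,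
      -(∑ k ∈ Finset.range (kψ + 1), ∑ i,
          lb i * h (traj f x (tust N x H) k) (tust N x H k) i)
        ≤ ψb (l1 (x - xs) + norm1H T (fun j => H j - h xs us)))
    -- the value function is attained by the unique minimizer `ustar`
    (hopt : ∀ (N : ℕ), ∀ x ∈ Prod.fst '' Z, ∀ H ∈ HSet h Z T,
      Admissible f h Z T N x H (ustar N x H) ∧
      cost f ℓ x (ustar N x H) N = Jstar f ℓ h Z T N x H ∧
      ∀ u : ℕ → Vec m, Admissible f h Z T N x H u →
        cost f ℓ x u N = Jstar f ℓ h Z T N x H → ∀ k < N, u k = ustar N x H k)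
    -- the rotated value function is attained by the unique minimizer `tust`
    (htopt : ∀ (N : ℕ), ∀ x ∈ Prod.fst '' Z, ∀ H ∈ HSet h Z T,
      Admissible f h Z T N x H (tust N x H) ∧
      rcost f ℓ h (ℓ xs us) lam lb x (tust N x H) N =
        Jtstar f ℓ h Z T (ℓ xs us) lam lb N x H ∧
      ∀ u : ℕ → Vec m, Admissible f h Z T N x H u →
        rcost f ℓ h (ℓ xs us) lam lb x u N =
          Jtstar f ℓ h Z T (ℓ xs us) lam lb N x H → ∀ k < N, u k = tust N x H k)
    :
    ∃ (N₂ N₆ : ℕ) (σ₃ σ₆ : ℕ → ℝ), LN σ₃ ∧ LN σ₆ ∧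
      ∀ x ∈ Prod.fst '' Z, ∀ H ∈ HSet h Z T, ∀ (K N : ℕ), N₆ + 1 ≤ N →
        (∑ k ∈ Finset.range K,
            ℓ (clTraj f h ustar N T (x, H) k).1
              (ustar N (clTraj f h ustar N T (x, H) k).1
                (clTraj f h ustar N T (x, H) k).2 0)) ≤
          Jstar f ℓ h Z T N x H -
            Jstar f ℓ h Z T N (clTraj f h ustar N T (x, H) K).1
              (clTraj f h ustar N T (x, H) K).2 +
            K * (ℓ xs us + σ₃ (N - (N₂ + T ^ 2 + 1))) ∧
        (∑ k ∈ Finset.range K,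
            rot f ℓ h (ℓ xs us) lam lb (clTraj f h ustar N T (x, H) k).1
              (ustar N (clTraj f h ustar N T (x, H) k).1
                (clTraj f h ustar N T (x, H) k).2 0)) ≤
          Jtstar f ℓ h Z T (ℓ xs us) lam lb N x H -
            Jtstar f ℓ h Z T (ℓ xs us) lam lb N (clTraj f h ustar N T (x, H) K).1
              (clTraj f h ustar N T (x, H) K).2 +
            σ₆ (N - (N₂ + (4 * T + 1) * (T - 1) + 1)) +
            K * σ₃ (N - (N₂ + T ^ 2 + 1)) +
            ψb (l1 (x - xs) + norm1H T (fun j => H j - h xs us)) +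
            ∑ k ∈ Finset.range K, ∑ i,
              lb i * h (clTraj f h ustar N T (x, H) k).1
                (ustar N (clTraj f h ustar N T (x, H) k).1
                  (clTraj f h ustar N T (x, H) k).2 0) i := by
  obtain ⟨αf, hαf, hfL⟩ := hfc
  obtain ⟨αl, hαl, hlL⟩ := halc
  obtain ⟨αm, hαm, hmL⟩ := hlamc
  obtain ⟨β₁, β₂, hβ₁, hβ₂, hac⟩ := hac
  have hxsX : xs ∈ Prod.fst '' Z := ⟨_, hzs, rfl⟩
  -- boundedness
  obtain ⟨R, hR0, hR⟩ : ∃ R : ℝ, 0 ≤ R ∧ ∀ z ∈ Z, ‖(z.1 - xs, z.2 - us)‖ ≤ R := by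
    obtain ⟨C, hC⟩ := hZ.isBounded.exists_norm_le
    have hC0 : 0 ≤ C := (norm_nonneg _).trans (hC _ hzs)
    refine ⟨C + C, by linarith, fun z hz => ?_⟩
    have : (z.1 - xs, z.2 - us) = z - (xs, us) := rfl
    rw [this]
    exact (norm_sub_le _ _).trans (add_le_add (hC z hz) (hC _ hzs))
  have hlB : ∀ z ∈ Z, |ℓ z.1 z.2 - ℓ xs us| ≤ αl R := fun z hz =>
    (hlL z hz (xs, us) hzs).trans (hαl.mono (norm_nonneg _) (hR z hz))
  have hXR : ∀ x ∈ Prod.fst '' Z, ‖x - xs‖ ≤ R := by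
    rintro x ⟨z, hz, rfl⟩
    exact (norm_fst_le (z.1 - xs, z.2 - us)).trans (hR z hz)
  have hmB : ∀ x ∈ Prod.fst '' Z, |lam x| ≤ αm R := by
    intro x hx
    have := (hmL x hx xs hxsX).trans (hαm.mono (norm_nonneg _) (hXR x hx))
    rwa [hlam0, sub_zero] at this
  have hhc : ∀ z ∈ Z, ∀ i, |h z.1 z.2 i - h xs us i| ≤ Lh * ‖(z.1 - xs, z.2 - us)‖ := by
    intro z hz i
    exact (coord_le_norm (h z.1 z.2 - h xs us) i).trans (hhL z hz (xs, us) hzs)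
  have hhB : ∀ z ∈ Z, ∀ i, |h z.1 z.2 i - h xs us i| ≤ Lh * R := fun z hz i =>
    (hhc z hz i).trans (mul_le_mul_of_nonneg_left (hR z hz) hLh.le)
  have hbd : ∀ z ∈ Z, ∀ i, sInf ((fun z : Vec n × Vec m => h z.1 z.2 i) '' Z) ≤ h z.1 z.2 i ∧
      h z.1 z.2 i ≤ sSup ((fun z : Vec n × Vec m => h z.1 z.2 i) '' Z) := by
    intro z hz i
    constructor
    · refine csInf_le ?_ (Set.mem_image_of_mem (fun z : Vec n × Vec m => h z.1 z.2 i) hz)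
      refine ⟨h xs us i - Lh * R, ?_⟩
      rintro _ ⟨y, hy, rfl⟩
      have := abs_le.mp (hhB y hy i)
      simp only
      linarith [this.1]
    · refine le_csSup ?_ (Set.mem_image_of_mem (fun z : Vec n × Vec m => h z.1 z.2 i) hz)
      refine ⟨h xs us i + Lh * R, ?_⟩
      rintro _ ⟨y, hy, rfl⟩
      have := abs_le.mp (hhB y hy i)
      simp only
      linarith [this.2]
  have hHB : ∀ H ∈ HSet h Z T, measH T (fun j => H j - h xs us) ≤ p * (Lh * R) := by
    intro H hH
    apply measH_le (by positivity)
    intro k hk1 hk2 i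
    have h1 := (hH k (Finset.mem_Icc.mpr (by omega)) i).2
    have h2 : sSup ((fun z : Vec n × Vec m => h z.1 z.2 i) '' Z) ≤ h xs us i + Lh * R := by
      refine csSup_le (Set.Nonempty.image _ ⟨_, hzs⟩) ?_
      rintro _ ⟨y, hy, rfl⟩
      have := abs_le.mp (hhB y hy i)
      simp only
      linarith [this.2]
    simp only [PiLp.sub_apply]
    linarith
  -- complementary slackness
  have hslack : ∑ i, lb i * h xs us i = 0 := by
    apply le_antisymm
    · exact Finset.sum_nonpos fun i _ => mul_nonpos_of_nonneg_of_nonpos (hlb i) (hhs i)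
    · have := hdiss (xs, us) hzs
      simp only [hfix, sub_self] at this
      have h0 : ‖((0 : Vec n), (0 : Vec m))‖ = 0 := by
        rw [← Prod.zero_eq_mk, norm_zero]
      rw [h0, hρ.2.2.1] at this
      linarith
  set SL : ℝ := ∑ i, lb i with hSL
  have hSL0 : 0 ≤ SL := Finset.sum_nonneg fun i _ => hlb i
  have hlbc : ∀ z ∈ Z, |∑ i, lb i * h z.1 z.2 i| ≤ SL * (Lh * ‖(z.1 - xs, z.2 - us)‖) := by
    intro z hz
    have e1 : ∑ i, lb i * h z.1 z.2 i = ∑ i, lb i * (h z.1 z.2 i - h xs us i) := by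
      simp only [mul_sub, Finset.sum_sub_distrib, hslack, sub_zero]
    rw [e1, hSL, Finset.sum_mul]
    refine (Finset.abs_sum_le_sum_abs _ _).trans (Finset.sum_le_sum fun i _ => ?_)
    rw [abs_mul, abs_of_nonneg (hlb i)]
    exact mul_le_mul_of_nonneg_left (hhc z hz i) (hlb i)
  have hlbB : ∀ z ∈ Z, ∑ i, lb i * h z.1 z.2 i ≤ SL * (Lh * R) := fun z hz =>
    (le_abs_self _).trans ((hlbc z hz).trans
      (mul_le_mul_of_nonneg_left (mul_le_mul_of_nonneg_left (hR z hz) hLh.le) hSL0))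
  have hρrot : ∀ z ∈ Z, ρ ‖(z.1 - xs, z.2 - us)‖ ≤ rot f ℓ h (ℓ xs us) lam lb z.1 z.2 := by
    intro z hz
    have := hdiss z hz
    simp only [rot]
    linarith
  have hρ0 : ∀ a : Vec n × Vec m, 0 ≤ ρ ‖a‖ := fun a => hρ.nonneg (norm_nonneg _)
  -- value functions are lower bounds
  have hJle : ∀ (N : ℕ) (x : Vec n) (H : ℕ → Vec p) (u : ℕ → Vec m),
      Admissible f h Z T N x H u → Jstar f ℓ h Z T N x H ≤ cost f ℓ x u N := by
    intro N x H u hu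
    refine csInf_le ?_ (Set.mem_image_of_mem _ hu)
    refine ⟨∑ k ∈ Finset.range N, (ℓ xs us - αl R), ?_⟩
    rintro _ ⟨v, hv, rfl⟩
    apply Finset.sum_le_sum
    intro k hk
    have := (abs_le.mp (hlB _ (hv.1 k (Finset.mem_range.mp hk)))).1
    simp only at this
    linarith
  have hJtle : ∀ (N : ℕ) (x : Vec n) (H : ℕ → Vec p) (u : ℕ → Vec m),
      Admissible f h Z T N x H u →
      Jtstar f ℓ h Z T (ℓ xs us) lam lb N x H ≤ rcost f ℓ h (ℓ xs us) lam lb x u N := by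
    intro N x H u hu
    refine csInf_le ?_ (Set.mem_image_of_mem _ hu)
    refine ⟨0, ?_⟩
    rintro _ ⟨v, hv, rfl⟩
    apply Finset.sum_nonneg
    intro k hk
    exact (hρ0 _).trans (hρrot (traj f x v k, v k) (hv.1 k (Finset.mem_range.mp hk)))
  -- turnpike bounds
  set CB : ℝ := ∑' k, β₁ R k + ∑' k, β₂ (p * (Lh * R)) k with hCB
  have hub : ∀ x ∈ Prod.fst '' Z, ∀ H ∈ HSet h Z T, ∀ N : ℕ,
      Jstar f ℓ h Z T N x H ≤ N * ℓ xs us + CB ∧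
      Jtstar f ℓ h Z T (ℓ xs us) lam lb N x H ≤ CB := by
    intro x hx H hH N
    obtain ⟨u, hu, hul⟩ := hac x hx H hH N
    have hsum : ∑ k ∈ Finset.range N,
        (β₁ ‖x - xs‖ k + β₂ (measH T (fun j => H j - h xs us)) k) ≤ CB := by
      rw [Finset.sum_add_distrib]
      exact add_le_add (hβ₁.sum_le (norm_nonneg _) (hXR x hx) N)
        (hβ₂.sum_le (measH_nonneg _ _) (hHB H hH) N)
    constructor
    · refine (hJle N x H u hu).trans ?_
      have : cost f ℓ x u N ≤ ∑ k ∈ Finset.range N,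
          (ℓ xs us + (β₁ ‖x - xs‖ k + β₂ (measH T (fun j => H j - h xs us)) k)) := by
        apply Finset.sum_le_sum
        intro k hk
        have := (hul k (Finset.mem_range.mp hk)).1
        linarith
      rw [Finset.sum_add_distrib, Finset.sum_const, Finset.card_range, nsmul_eq_mul] at this
      linarith
    · refine (hJtle N x H u hu).trans (le_trans ?_ hsum)
      apply Finset.sum_le_sum
      intro k hk
      exact (hul k (Finset.mem_range.mp hk)).2
  have hρsum : ∀ (N M : ℕ) (x : Vec n) (H : ℕ → Vec p) (u : ℕ → Vec m),
      Admissible f h Z T N x H u → M ≤ N →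
      ∑ k ∈ Finset.range M, ρ ‖(traj f x u k - xs, u k - us)‖ ≤
        rcost f ℓ h (ℓ xs us) lam lb x u M := by
    intro N M x H u hu hMN
    apply Finset.sum_le_sum
    intro k hk
    have hk' : k < N := lt_of_lt_of_le (Finset.mem_range.mp hk) hMN
    exact hρrot (traj f x u k, u k) (hu.1 k hk')
  set C : ℝ := CB + αl R + 2 * αm R + T * (SL * (Lh * R)) with hC
  have hαlR := hαl.nonneg hR0
  have hαmR := hαm.nonneg hR0
  have hturn : ∀ x ∈ Prod.fst '' Z, ∀ H ∈ HSet h Z T, ∀ N : ℕ,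
      ∑ k ∈ Finset.range N, ρ ‖(traj f x (ustar (N + 1) x H) k - xs,
        ustar (N + 1) x H k - us)‖ ≤ C := by
    intro x hx H hH N
    obtain ⟨hu, hue, -⟩ := hopt (N + 1) x hx H hH
    refine (hρsum (N + 1) N x H _ hu (by omega)).trans ?_
    rw [rcost_eq]
    have h1 := (hub x hx H hH (N + 1)).1
    have hzN := hu.1 N (by omega)
    have h2 : cost f ℓ x (ustar (N + 1) x H) (N + 1) = cost f ℓ x (ustar (N + 1) x H) N
        + ℓ (traj f x (ustar (N + 1) x H) N) (ustar (N + 1) x H N) := by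
      simp only [cost]; rw [Finset.sum_range_succ]
    have h3 := (abs_le.mp (hlB _ hzN)).1
    simp only at h3
    have h4 := (abs_le.mp (hmB x hx)).2
    have h5 := (abs_le.mp (hmB _ ⟨_, hzN, rfl⟩)).1
    simp only at h5
    have h6 := sum_lb_le f h Z hT hlb (by positivity) hlbB hu N (by omega)
    push_cast at h1
    linarith
  have htturn : ∀ x ∈ Prod.fst '' Z, ∀ H ∈ HSet h Z T, ∀ N : ℕ,
      ∑ k ∈ Finset.range N, ρ ‖(traj f x (tust (N + 1) x H) k - xs,
        tust (N + 1) x H k - us)‖ ≤ C := by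
    intro x hx H hH N
    obtain ⟨hu, hue, -⟩ := htopt (N + 1) x hx H hH
    have h0 : ∑ k ∈ Finset.range N, ρ ‖(traj f x (tust (N + 1) x H) k - xs,
        tust (N + 1) x H k - us)‖ ≤ ∑ k ∈ Finset.range (N + 1),
        ρ ‖(traj f x (tust (N + 1) x H) k - xs, tust (N + 1) x H k - us)‖ := by
      rw [Finset.sum_range_succ]
      linarith [hρ0 (traj f x (tust (N + 1) x H) N - xs, tust (N + 1) x H N - us)]
    have h1 := hρsum (N + 1) (N + 1) x H _ hu le_rfl
    have h2 := (hub x hx H hH (N + 1)).2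
    have h3 : 0 ≤ T * (SL * (Lh * R)) := by positivity
    linarith
  -- continuity near the steady state
  have hcont : ∀ η > 0, ∃ ε > 0, ∀ z ∈ Z, ‖(z.1 - xs, z.2 - us)‖ ≤ ε →
      |ℓ z.1 z.2 - ℓ xs us| ≤ η ∧ |lam z.1| ≤ η ∧
      (f z.1 z.2 ∈ Prod.fst '' Z → |rot f ℓ h (ℓ xs us) lam lb z.1 z.2| ≤ η) := by
    intro η hη
    obtain ⟨ε1, hε1, h1⟩ := hαl.small (show 0 < η / 4 by positivity)
    obtain ⟨ε2, hε2, h2⟩ := hαm.small (show 0 < η / 4 by positivity)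
    obtain ⟨ε3, hε3, h3⟩ := hαf.small hε2
    have hden : 0 < SL * Lh + 1 := by positivity
    refine ⟨min (min ε1 ε2) (min ε3 (η / 4 / (SL * Lh + 1))), by positivity, ?_⟩
    intro z hz hze
    have b1 := hze.trans ((min_le_left _ _).trans (min_le_left _ _))
    have b2 := hze.trans ((min_le_left _ _).trans (min_le_right _ _))
    have b3 := hze.trans ((min_le_right _ _).trans (min_le_left _ _))
    have b4 := hze.trans ((min_le_right _ _).trans (min_le_right _ _))
    have hn0 := norm_nonneg (z.1 - xs, z.2 - us)
    have c1 : |ℓ z.1 z.2 - ℓ xs us| ≤ η / 4 :=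
      (hlL z hz (xs, us) hzs).trans (h1 _ hn0 b1)
    have c2 : |lam z.1| ≤ η / 4 := by
      have := hmL z.1 ⟨z, hz, rfl⟩ xs hxsX
      rw [hlam0, sub_zero] at this
      exact this.trans (h2 _ (norm_nonneg _) ((norm_fst_le (z.1 - xs, z.2 - us)).trans b2))
    refine ⟨by linarith, by linarith, fun hfz => ?_⟩
    have c3 : |lam (f z.1 z.2)| ≤ η / 4 := by
      have e1 := hmL _ hfz xs hxsX
      rw [hlam0, sub_zero] at e1
      have e2 := hfL z hz (xs, us) hzs
      simp only [hfix] at e2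
      exact e1.trans (h2 _ (norm_nonneg _) (e2.trans (h3 _ hn0 b3)))
    have c4 : |∑ i, lb i * h z.1 z.2 i| ≤ η / 4 := by
      refine (hlbc z hz).trans ?_
      rw [le_div_iff₀ hden] at b4
      nlinarith
    have d1 := abs_le.mp c1
    have d2 := abs_le.mp c2
    have d3 := abs_le.mp c3
    have d4 := abs_le.mp c4
    simp only [rot]
    rw [abs_le]
    constructor <;> linarith [d1.1, d1.2, d2.1, d2.2, d3.1, d3.2, d4.1, d4.2]
  -- key estimates
  have hkey : ∀ e > 0, ∃ N0 : ℕ, ∀ M ≥ N0,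
      (∀ x ∈ Prod.fst '' Z, ∀ H ∈ HSet h Z T,
        Jstar f ℓ h Z T (M + 1 + 1) x H ≤ Jstar f ℓ h Z T (M + 1) x H + ℓ xs us + e) ∧
      (∀ x ∈ Prod.fst '' Z, ∀ H ∈ HSet h Z T, ∀ x' ∈ Prod.fst '' Z, ∀ H' ∈ HSet h Z T,
        Jstar f ℓ h Z T (M + 1) x H + lam x - Jstar f ℓ h Z T (M + 1) x' H' - lam x' ≤
          Jtstar f ℓ h Z T (ℓ xs us) lam lb (M + 1) x H
          - Jtstar f ℓ h Z T (ℓ xs us) lam lb (M + 1) x' H' + e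
          + ψb (l1 (x - xs) + norm1H T (fun j => H j - h xs us))) := by
    intro e he
    set η : ℝ := e / (4 * d + 4) with hη
    have hηpos : 0 < η := by positivity
    have hηe : (4 * d + 4) * η = e := by
      rw [hη]; field_simp
    obtain ⟨ε0, hε0, hnear⟩ := hcont η hηpos
    obtain ⟨ε1, hε1, hspl⟩ := splice f h Z hT hLh hhL hzs hfix hhs hbd hδc hEh hγx hγu hloc hε0
    obtain ⟨M0, hM0⟩ := exists_window' hρ C T d hT (show 0 < min ε0 ε1 from lt_min hε0 hε1)
    have hl0 : min ε0 ε1 ≤ ε0 := min_le_left _ _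
    have hl1 : min ε0 ε1 ≤ ε1 := min_le_right _ _
    -- stage costs near the steady state
    have hℓn : ∀ (N : ℕ) (x : Vec n) (H : ℕ → Vec p) (u : ℕ → Vec m) (k : ℕ),
        Admissible f h Z T N x H u → k < N → ‖(traj f x u k - xs, u k - us)‖ ≤ ε0 →
        |ℓ (traj f x u k) (u k) - ℓ xs us| ≤ η := fun N x H u k hu hk hk2 =>
      (hnear (traj f x u k, u k) (hu.1 k hk) hk2).1
    have hrn : ∀ (N : ℕ) (x : Vec n) (H : ℕ → Vec p) (u : ℕ → Vec m) (k : ℕ),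
        Admissible f h Z T N x H u → k + 1 < N → ‖(traj f x u k - xs, u k - us)‖ ≤ ε0 →
        |rot f ℓ h (ℓ xs us) lam lb (traj f x u k) (u k) - 0| ≤ η := by
      intro N x H u k hu hk hk2
      rw [sub_zero]
      exact (hnear (traj f x u k, u k) (hu.1 k (by omega)) hk2).2.2 ⟨_, hu.1 (k + 1) hk, rfl⟩
    refine ⟨M0, fun M hM => ⟨?_, ?_⟩⟩
    · intro x hx H hH
      obtain ⟨hu, hue, -⟩ := hopt (M + 1) x hx H hH
      set w := ustar (M + 1) x H with hw
      obtain ⟨r, q, S, hq, hMS, hwin⟩ := hM0 M hM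
        (fun k => ‖(traj f x w k - xs, w k - us)‖) (fun k => ‖(traj f x w k - xs, w k - us)‖)
        (fun k => norm_nonneg _) (fun k => norm_nonneg _) (hturn x hx H hH M) (hturn x hx H hH M)
      have hMS' : M + 1 = T + r + (d + (T + (S + 2))) := by omega
      obtain ⟨v, hv, hv1, hv2, hv3⟩ := hspl x x H H w w (M + 1) (r + 1) r (S + 2) hu
        (hMS' ▸ hu) (by omega)
        (fun k hk1 hk2 => (hwin k (by omega) (by omega)).1.trans hl1)
        (fun k hk1 hk2 => (hwin k (by omega) (by omega)).1.trans hl1)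
      have hlen : T + (r + 1) + (d + (T + (S + 2))) = M + 1 + 1 := by omega
      have hs := sum_splice (fun k => ℓ (traj f x v k) (v k)) (fun k => ℓ (traj f x w k) (w k))
        (fun k => ℓ (traj f x w k) (w k)) (T + (r + 1)) (T + r) d (T + (S + 2))
        (fun k hk => by simp only [(hv1 k hk).1, (hv1 k hk).2])
        (fun k => by simp only [(hv3 k).1, (hv3 k).2])
      rw [hlen, ← hMS'] at hs
      rw [hlen] at hv
      have hJ := hJle (M + 1 + 1) x H v hv
      have n1 := sum_near (fun k => ℓ (traj f x v (T + (r + 1) + k)) (v (T + (r + 1) + k))) d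
        (ℓ xs us) η (fun k hk => hℓn (M + 1 + 1) x H v _ hv (by omega) (hv2 k hk))
      have n2 := sum_near (fun k => ℓ (traj f x w (T + r + k)) (w (T + r + k))) d
        (ℓ xs us) η (fun k hk => hℓn (M + 1) x H w _ hu (by omega)
          ((hwin _ (by omega) (by omega)).1.trans hl0))
      have n3 := hℓn (M + 1) x H w (T + r) hu (by omega)
        ((hwin _ (by omega) (by omega)).1.trans hl0)
      have n4 : ∑ k ∈ Finset.range (T + (r + 1)), ℓ (traj f x w k) (w k)
          = ∑ k ∈ Finset.range (T + r), ℓ (traj f x w k) (w k)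
            + ℓ (traj f x w (T + r)) (w (T + r)) := by
        rw [← add_assoc, Finset.sum_range_succ]
      have m1 := (abs_le.mp n1).2
      have m2 := (abs_le.mp n2).1
      have m3 := (abs_le.mp n3).2
      simp only [cost] at hJ hue
      have hdη : 0 ≤ d * η := by positivity
      linarith
    · intro x hx H hH x' hx' H' hH'
      obtain ⟨hu, hue, -⟩ := htopt (M + 1) x hx H hH
      obtain ⟨hu', hue', -⟩ := hopt (M + 1) x' hx' H' hH'
      have hψ1 := fun k hk => hψ k hk (M + 1) x hx H hH
      have ht1 := htturn x hx H hH M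
      have ht2 := hturn x' hx' H' hH' M
      set u := tust (M + 1) x H with hudef
      set u' := ustar (M + 1) x' H' with hudef'
      obtain ⟨r, q, S, hq, hMS, hwin⟩ := hM0 M hM
        (fun k => ‖(traj f x u k - xs, u k - us)‖) (fun k => ‖(traj f x' u' k - xs, u' k - us)‖)
        (fun k => norm_nonneg _) (fun k => norm_nonneg _) ht1 ht2
      obtain ⟨v, hv, hv1, hv2, hv3⟩ := hspl x x' H H' u u' (M + 1) (r + 1) (r + 1) (S + 1) hu
        (hMS ▸ hu') (by omega)
        (fun k hk1 hk2 => (hwin k (by omega) (by omega)).1.trans hl1)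
        (fun k hk1 hk2 => (hwin k (by omega) (by omega)).2.trans hl1)
      obtain ⟨v', hv', hv1', hv2', hv3'⟩ := hspl x' x H' H u' u (M + 1) (r + 1) (r + 1) (S + 1) hu'
        (hMS ▸ hu) (by omega)
        (fun k hk1 hk2 => (hwin k (by omega) (by omega)).2.trans hl1)
        (fun k hk1 hk2 => (hwin k (by omega) (by omega)).1.trans hl1)
      have hs := sum_splice (fun k => ℓ (traj f x v k) (v k)) (fun k => ℓ (traj f x u k) (u k))
        (fun k => ℓ (traj f x' u' k) (u' k)) (T + (r + 1)) (T + (r + 1)) d (T + (S + 1))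
        (fun k hk => by simp only [(hv1 k hk).1, (hv1 k hk).2])
        (fun k => by simp only [(hv3 k).1, (hv3 k).2])
      have hs' := sum_splice (fun k => rot f ℓ h (ℓ xs us) lam lb (traj f x' v' k) (v' k))
        (fun k => rot f ℓ h (ℓ xs us) lam lb (traj f x' u' k) (u' k))
        (fun k => rot f ℓ h (ℓ xs us) lam lb (traj f x u k) (u k))
        (T + (r + 1)) (T + (r + 1)) d (T + (S + 1))
        (fun k hk => by simp only [(hv1' k hk).1, (hv1' k hk).2])
        (fun k => by simp only [(hv3' k).1, (hv3' k).2])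
      rw [← hMS] at hs hs' hv hv'
      have hJ := hJle (M + 1) x H v hv
      have hJ' := hJtle (M + 1) x' H' v' hv'
      have n1 := sum_near (fun k => ℓ (traj f x v (T + (r + 1) + k)) (v (T + (r + 1) + k))) d
        (ℓ xs us) η (fun k hk => hℓn (M + 1) x H v _ hv (by omega) (hv2 k hk))
      have n2 := sum_near (fun k => ℓ (traj f x' u' (T + (r + 1) + k)) (u' (T + (r + 1) + k))) d
        (ℓ xs us) η (fun k hk => hℓn (M + 1) x' H' u' _ hu' (by omega)
          ((hwin _ (by omega) (by omega)).2.trans hl0))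
      have n3 := sum_near (fun k => rot f ℓ h (ℓ xs us) lam lb (traj f x' v' (T + (r + 1) + k))
        (v' (T + (r + 1) + k))) d 0 η
        (fun k hk => hrn (M + 1) x' H' v' _ hv' (by omega) (hv2' k hk))
      have n4 := sum_near (fun k => rot f ℓ h (ℓ xs us) lam lb (traj f x u (T + (r + 1) + k))
        (u (T + (r + 1) + k))) d 0 η
        (fun k hk => hrn (M + 1) x H u _ hu (by omega)
          ((hwin _ (by omega) (by omega)).1.trans hl0))
      have lamA := abs_le.mp (hnear (traj f x u (T + (r + 1)), u (T + (r + 1))) (hu.1 (T + (r + 1)) (by omega))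
        ((hwin _ (by omega) (by omega)).1.trans hl0)).2.1
      have lamB := abs_le.mp (hnear (traj f x' u' (T + (r + 1)), u' (T + (r + 1))) (hu'.1 (T + (r + 1)) (by omega))
        ((hwin _ (by omega) (by omega)).2.trans hl0)).2.1
      simp only at lamA lamB
      have hP := hψ1 (T + r) (by omega)
      rw [add_assoc T r 1] at hP
      have hP' := sum_lb_nonpos f h Z hlb hu' q (by omega)
      rw [← hq] at hP'
      have r1 := rcost_eq f ℓ h (ℓ xs us) lam lb x u (T + (r + 1))
      have r2 := rcost_eq f ℓ h (ℓ xs us) lam lb x' u' (T + (r + 1))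
      have m1 := (abs_le.mp n1).2
      have m2 := (abs_le.mp n2).1
      have m3 := (abs_le.mp n3).2
      have m4 := (abs_le.mp n4).1
      simp only [cost, rcost] at hJ hJ' hue hue' r1 r2
      linarith [lamA.1, lamA.2, lamB.1, lamB.2]
  -- extraction of the comparison functions
  obtain ⟨Na, σ₃, hσ₃, hNa⟩ := exists_LN (fun N e => ∀ x ∈ Prod.fst '' Z, ∀ H ∈ HSet h Z T,
      Jstar f ℓ h Z T N x H ≤ Jstar f ℓ h Z T (N - 1) x H + ℓ xs us + e) (0 + T ^ 2 + 1)
    (by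
      intro e he
      obtain ⟨N0, hN0⟩ := hkey e he
      refine ⟨N0 + 2, fun N hN => ?_⟩
      obtain ⟨M, rfl⟩ : ∃ M, N = M + 1 + 1 := ⟨N - 2, by omega⟩
      exact (hN0 M (by omega)).1)
    (by
      intro N a ha x hx H hH
      apply le_of_forall_pos_le_add
      intro e he
      have := ha (a + e) (by linarith) x hx H hH
      linarith)
    (by
      intro N a b hab ha x hx H hH
      have := ha x hx H hH
      linarith)
  obtain ⟨Nb, σ₆, hσ₆, hNb⟩ := exists_LN (fun N e => ∀ x ∈ Prod.fst '' Z, ∀ H ∈ HSet h Z T,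
      ∀ x' ∈ Prod.fst '' Z, ∀ H' ∈ HSet h Z T,
        Jstar f ℓ h Z T N x H + lam x - Jstar f ℓ h Z T N x' H' - lam x' ≤
          Jtstar f ℓ h Z T (ℓ xs us) lam lb N x H
          - Jtstar f ℓ h Z T (ℓ xs us) lam lb N x' H' + e
          + ψb (l1 (x - xs) + norm1H T (fun j => H j - h xs us)))
    (0 + (4 * T + 1) * (T - 1) + 1)
    (by
      intro e he
      obtain ⟨N0, hN0⟩ := hkey e he
      refine ⟨N0 + 1, fun N hN => ?_⟩
      obtain ⟨M, rfl⟩ : ∃ M, N = M + 1 := ⟨N - 1, by omega⟩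
      exact (hN0 M (by omega)).2)
    (by
      intro N a ha x hx H hH x' hx' H' hH'
      apply le_of_forall_pos_le_add
      intro e he
      have := ha (a + e) (by linarith) x hx H hH x' hx' H' hH'
      linarith)
    (by
      intro N a b hab ha x hx H hH x' hx' H' hH'
      have := ha x hx H hH x' hx' H' hH'
      linarith)
  refine ⟨0, Na + Nb + T + 1, σ₃, σ₆, hσ₃, hσ₆, ?_⟩
  intro x hx H hH K N hN
  obtain ⟨M, rfl⟩ : ∃ M, N = M + 1 := ⟨N - 1, by omega⟩
  have h3 := hNa (M + 1) (by omega)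
  have h6 := hNb (M + 1) (by omega)
  simp only [Nat.add_sub_cancel] at h3
  -- one closed-loop step
  have hstep : ∀ y ∈ Prod.fst '' Z, ∀ G ∈ HSet h Z T,
      f y (ustar (M + 1) y G 0) ∈ Prod.fst '' Z ∧
      shiftH T G (h y (ustar (M + 1) y G 0)) ∈ HSet h Z T := by
    intro y hy G hG
    obtain ⟨hu, -, -⟩ := hopt (M + 1) y hy G hG
    refine ⟨⟨_, hu.1 1 (by omega), rfl⟩, ?_⟩
    intro k hk i
    rw [Finset.mem_Icc] at hk
    by_cases hkT : k + 1 < T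
    · simp only [shiftH]
      rw [if_pos hkT]
      exact hG (k + 1) (Finset.mem_Icc.mpr (by omega)) i
    · simp only [shiftH]
      rw [if_neg hkT, if_pos (by omega)]
      exact hbd (y, ustar (M + 1) y G 0) (hu.1 0 (by omega)) i
  have hinv : ∀ k, (clTraj f h ustar (M + 1) T (x, H) k).1 ∈ Prod.fst '' Z ∧
      (clTraj f h ustar (M + 1) T (x, H) k).2 ∈ HSet h Z T := by
    intro k
    induction k with
    | zero => exact ⟨hx, hH⟩
    | succ k ih => exact hstep _ ih.1 _ ih.2
  have hdec : ∀ y ∈ Prod.fst '' Z, ∀ G ∈ HSet h Z T,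
      ℓ y (ustar (M + 1) y G 0) ≤ Jstar f ℓ h Z T (M + 1) y G
        - Jstar f ℓ h Z T (M + 1) (f y (ustar (M + 1) y G 0))
          (shiftH T G (h y (ustar (M + 1) y G 0)))
        + (ℓ xs us + σ₃ (M + 1 - (0 + T ^ 2 + 1))) := by
    intro y hy G hG
    obtain ⟨hu, hue, -⟩ := hopt (M + 1) y hy G hG
    have a1 := hJle M _ _ _ (adm_step f h Z hT (by omega) hu)
    rw [cost_step] at hue
    have a2 := h3 _ (hstep y hy G hG).1 _ (hstep y hy G hG).2
    linarith
  have hi : (∑ k ∈ Finset.range K,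
            ℓ (clTraj f h ustar (M + 1) T (x, H) k).1
              (ustar (M + 1) (clTraj f h ustar (M + 1) T (x, H) k).1
                (clTraj f h ustar (M + 1) T (x, H) k).2 0)) ≤
          Jstar f ℓ h Z T (M + 1) x H -
            Jstar f ℓ h Z T (M + 1) (clTraj f h ustar (M + 1) T (x, H) K).1
              (clTraj f h ustar (M + 1) T (x, H) K).2 +
            K * (ℓ xs us + σ₃ (M + 1 - (0 + T ^ 2 + 1))) := by
    induction K with
    | zero => simp [clTraj]
    | succ K ih =>
      rw [Finset.sum_range_succ]
      have := hdec _ (hinv K).1 _ (hinv K).2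
      rw [Nat.cast_succ]
      simp only [clTraj]
      linarith
  refine ⟨hi, ?_⟩
  have hrot : (∑ k ∈ Finset.range K,
            rot f ℓ h (ℓ xs us) lam lb (clTraj f h ustar (M + 1) T (x, H) k).1
              (ustar (M + 1) (clTraj f h ustar (M + 1) T (x, H) k).1
                (clTraj f h ustar (M + 1) T (x, H) k).2 0)) =
          (∑ k ∈ Finset.range K,
            ℓ (clTraj f h ustar (M + 1) T (x, H) k).1
              (ustar (M + 1) (clTraj f h ustar (M + 1) T (x, H) k).1
                (clTraj f h ustar (M + 1) T (x, H) k).2 0)) - K * ℓ xs us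
          + lam x - lam (clTraj f h ustar (M + 1) T (x, H) K).1
          + ∑ k ∈ Finset.range K, ∑ i,
              lb i * h (clTraj f h ustar (M + 1) T (x, H) k).1
                (ustar (M + 1) (clTraj f h ustar (M + 1) T (x, H) k).1
                  (clTraj f h ustar (M + 1) T (x, H) k).2 0) i := by
    clear hi
    induction K with
    | zero => simp [clTraj]
    | succ K ih =>
      rw [Finset.sum_range_succ, ih, Finset.sum_range_succ _ K, Finset.sum_range_succ _ K]
      simp only [rot, clTraj]
      push_cast
      ring
  have hfin := h6 x hx H hH _ (hinv K).1 _ (hinv K).2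
  rw [hrot]
  linarith

end EMPC
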